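/- For every finite nonempty subtree X of T containing the identity e, there exists a finite open cover {U_C} of the decomposition space D, indexed by the connected components C of T ∖ X, such that: (1) q(∂C) ⊆ U_C for every component C; (2) for distinct components C and C′, U_C ∩ U_{C′} ≠ ∅ if and only if some line in L has one endpoint in ∂C and the other endpoint in ∂C′; and (3) U_C ∩ U_{C′} ∩ U_{C″} = ∅ for any pairwise distinct components C, C′, C″. -/

import Mathlib

open scoped BigOperators

namespace DecompPaper

variable (B : Type) [DecidableEq B]

/-- The set of letters `B ⊔ B⁻¹` carries the discrete topology. -/
instance : TopologicalSpace (B × Bool) := ⊥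

/-- The Gromov boundary `∂F` of the free group on `B`: the space of infinite reduced
words, i.e. sequences of letters with no cancelling adjacent pair, topologized as a
subspace of the product of discrete spaces. -/
abbrev Boundary : Type :=
  {s : ℕ → B × Bool // ∀ k, s (k + 1) ≠ ((s k).1, !(s k).2)}

/-- The prefix of length `m` of an infinite reduced word, as an element of the free group. -/
def prefixOf (ξ : Boundary B) (m : ℕ) : FreeGroup B :=
  FreeGroup.mk (List.ofFn fun i : Fin m => ξ.1 i)

/-- Adjacency in the Cayley graph `T` of the free group with respect to `B`. -/
def Adj (g h : FreeGroup B) : Prop :=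
  ∃ x : B × Bool, h = g * FreeGroup.mk [x]

/-- A set of vertices of `T` is a subtree iff any two of its vertices are joined by a
path in the Cayley graph staying inside the set. -/
def IsSubtree (X : Set (FreeGroup B)) : Prop :=
  ∀ g ∈ X, ∀ h ∈ X, Relation.ReflTransGen (fun a b => Adj B a b ∧ b ∈ X) g h

/-- `C` is a connected component of `T ∖ X`. -/
def IsComponentOf (X C : Set (FreeGroup B)) : Prop :=
  ∃ v, v ∉ X ∧
    C = {u | Relation.ReflTransGen (fun a b => Adj B a b ∧ a ∉ X ∧ b ∉ X) v u}

/-- `∂C`: the set of boundary points all of whose sufficiently long prefixes lie in `C`. -/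
def boundaryOf (C : Set (FreeGroup B)) : Set (Boundary B) :=
  {ξ | ∃ m, ∀ k, m ≤ k → prefixOf B ξ k ∈ C}

/-- The sequence `a` of group elements converges to the boundary point `ξ`:
every prefix of `ξ` is eventually an initial segment of the reduced word of `a k`. -/
def TendstoBoundary (a : ℕ → FreeGroup B) (ξ : Boundary B) : Prop :=
  ∀ m : ℕ, ∃ K, ∀ k, K ≤ k → (List.ofFn fun i : Fin m => ξ.1 i) <+: (a k).toWord

/-- `{ξ, η}` is a line of the line pattern generated by the words `w i`: for some
`g` and `i`, `ξ` and `η` are the limits of `g * (w i) ^ k` as `k → +∞` and `k → -∞`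
(in one of the two orders). -/
def IsLine {r : ℕ} (w : Fin r → FreeGroup B) (ξ η : Boundary B) : Prop :=
  ∃ (g : FreeGroup B) (i : Fin r),
    (TendstoBoundary B (fun k => g * w i ^ k) ξ ∧
       TendstoBoundary B (fun k => g * (w i)⁻¹ ^ k) η) ∨
    (TendstoBoundary B (fun k => g * w i ^ k) η ∧
       TendstoBoundary B (fun k => g * (w i)⁻¹ ^ k) ξ)

/-- Malnormality of the family of cyclic subgroups `⟨w i⟩`. -/
def Malnormal {r : ℕ} (w : Fin r → FreeGroup B) : Prop :=
  ∀ (g : FreeGroup B) (i j : Fin r),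
    (∃ x : FreeGroup B, x ∈ Subgroup.zpowers (w i) ∧ x ≠ 1 ∧
        g * x * g⁻¹ ∈ Subgroup.zpowers (w j)) →
      i = j ∧ g ∈ Subgroup.zpowers (w i)

/-- The decomposition space `D`: the quotient of `∂F` by the smallest equivalence
relation identifying the two endpoints of each line, with the quotient topology. -/
abbrev DSpace {r : ℕ} (w : Fin r → FreeGroup B) : Type :=
  Quot (IsLine B w)

/-- The quotient projection `q : ∂F → D`. -/
def qmap {r : ℕ} (w : Fin r → FreeGroup B) : Boundary B → DSpace B w :=
  Quot.mk _

/-- The geodesic of the line with endpoints `ξ` and `η`: all prefixes of `ξ` or of `η`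
of length at least the length of their longest common initial segment. -/
def lineGeodesic (ξ η : Boundary B) : Set (FreeGroup B) :=
  {g | ∃ k : ℕ, (g = prefixOf B ξ k ∨ g = prefixOf B η k) ∧ ∃ i ≤ k, ξ.1 i ≠ η.1 i}

/-- The line with endpoints `ξ, η` passes through the subtree `X`. -/
def PassesThrough (ξ η : Boundary B) (X : Set (FreeGroup B)) : Prop :=
  ∃ g ∈ X, g ∈ lineGeodesic B ξ η

/-- A function `σ : D → ℤ` is supported on the subtree `X` if `σ ∘ q` is constant on
`∂C` for every connected component `C` of `T ∖ X`. -/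
def SupportedOn {r : ℕ} (w : Fin r → FreeGroup B) (σ : DSpace B w → ℤ)
    (X : Set (FreeGroup B)) : Prop :=
  ∀ C : Set (FreeGroup B), IsComponentOf B X C →
    ∀ ξ, ξ ∈ boundaryOf B C → ∀ η, η ∈ boundaryOf B C →
      σ (qmap B w ξ) = σ (qmap B w η)

/-- Prepending a letter to an infinite reduced word, cancelling if necessary. -/
def consB (x : B × Bool) (ξ : Boundary B) : Boundary B :=
  if h : ξ.1 0 = (x.1, !x.2) then
    ⟨fun k => ξ.1 (k + 1), fun k => ξ.2 (k + 1)⟩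
  else
    ⟨fun k => Nat.rec x (fun j _ => ξ.1 j) k, by
      intro k
      cases k with
      | zero => exact h
      | succ j => exact ξ.2 j⟩

/-- The action of the free group on its boundary: left multiplication followed by
reduction. -/
def actB (g : FreeGroup B) (ξ : Boundary B) : Boundary B :=
  g.toWord.foldr (consB B) ξ

/-- The induced action of the free group on the decomposition space. -/
noncomputable def actD {r : ℕ} (w : Fin r → FreeGroup B) (g : FreeGroup B)
    (x : DSpace B w) : DSpace B w :=
  qmap B w (actB B g (Quot.out x))

/-- The map `p : (ℤ[F])^k → C(D, ℤ)` of right `ℤ[F]`-modules determined by generators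
`σ j`, where an element of the free module `(ℤ[F])^k` is recorded as a finitely
supported function `(Fin k × F) →₀ ℤ` and `e_j · g` is sent to `σ j · g`. -/
noncomputable def pMap {r : ℕ} (w : Fin r → FreeGroup B) {k : ℕ}
    (σ : Fin k → DSpace B w → ℤ) (x : (Fin k × FreeGroup B) →₀ ℤ) :
    DSpace B w → ℤ :=
  fun d => x.sum fun p n => n * σ p.1 (actD B w p.2 d)

/-- Right translation by `g` on the free module `(ℤ[F])^k`, sending `e_j · h` to
`e_j · (h * g)`. -/
noncomputable def fsTranslate {k : ℕ} (y : (Fin k × FreeGroup B) →₀ ℤ)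
    (g : FreeGroup B) : (Fin k × FreeGroup B) →₀ ℤ :=
  Finsupp.mapDomain (fun p => (p.1, p.2 * g)) y

/-- The convex hull of a set of vertices of `T`: the smallest subtree containing it. -/
def hull (S : Set (FreeGroup B)) : Set (FreeGroup B) :=
  ⋂₀ {Y : Set (FreeGroup B) | IsSubtree B Y ∧ S ⊆ Y}

/-- The support of an element of the free module `(ℤ[F])^k`, relative to supports
`X j` of the generators: the convex hull of the union of the sets `g⁻¹ • X j` over
the pairs `(j, g)` appearing with nonzero coefficient. -/
def fsSupport {k : ℕ} (X : Fin k → Set (FreeGroup B))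
    (x : (Fin k × FreeGroup B) →₀ ℤ) : Set (FreeGroup B) :=
  hull B (⋃ p ∈ x.support, (fun v => p.2⁻¹ * v) '' X p.1)

/-- Antisymmetry of a `1`-cochain on oriented lines. -/
def Antisym {r : ℕ} (w : Fin r → FreeGroup B)
    (f : Boundary B → Boundary B → ℤ) : Prop :=
  ∀ ξ η, IsLine B w ξ η → f η ξ = -f ξ η

/-- A `1`-cochain is supported on the subtree `X`: it vanishes on lines not passing
through `X`, and depends only on the pair of components of `T ∖ X` containing the two
endpoints. -/
def SupportedOn1 {r : ℕ} (w : Fin r → FreeGroup B)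
    (f : Boundary B → Boundary B → ℤ) (X : Set (FreeGroup B)) : Prop :=
  (∀ ξ η, IsLine B w ξ η → ¬PassesThrough B ξ η X → f ξ η = 0) ∧
  (∀ C C' : Set (FreeGroup B), IsComponentOf B X C → IsComponentOf B X C' → C ≠ C' →
    ∀ ξ ξ' η η', IsLine B w ξ η → IsLine B w ξ' η' →
      ξ ∈ boundaryOf B C → ξ' ∈ boundaryOf B C →
      η ∈ boundaryOf B C' → η' ∈ boundaryOf B C' →
      f ξ η = f ξ' η')

/-- Membership in `C¹`: an antisymmetric integer-valued function on oriented lines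
supported on at least one finite nonempty subtree of `T`. -/
def MemC1 {r : ℕ} (w : Fin r → FreeGroup B)
    (f : Boundary B → Boundary B → ℤ) : Prop :=
  Antisym B w f ∧
    ∃ X : Set (FreeGroup B), X.Finite ∧ X.Nonempty ∧ IsSubtree B X ∧
      SupportedOn1 B w f X

/-- The ball of radius `R` about a set `Y` of vertices of `T` (word metric). -/
def ballAbout (Y : Set (FreeGroup B)) (R : ℕ) : Set (FreeGroup B) :=
  {g | ∃ y ∈ Y, (y⁻¹ * g).toWord.length ≤ R}

/-- The map `p : (ℤ[F])^k → C¹` of right `ℤ[F]`-modules determined by generators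
`f j`, sending `e_j · g` to `f j · g`. -/
noncomputable def pC1 {k : ℕ} (f : Fin k → Boundary B → Boundary B → ℤ)
    (x : (Fin k × FreeGroup B) →₀ ℤ) : Boundary B → Boundary B → ℤ :=
  fun ξ η => x.sum fun p n => n * f p.1 (actB B p.2 ξ) (actB B p.2 η)

/-- `σ : ∂F → ℤ` is constant on `∂C` for every connected component `C` of `T ∖ X`. -/
def ConstOnComponents (X : Set (FreeGroup B)) (σ : Boundary B → ℤ) : Prop :=
  ∀ C : Set (FreeGroup B), IsComponentOf B X C →
    ∀ ξ, ξ ∈ boundaryOf B C → ∀ η, η ∈ boundaryOf B C → σ ξ = σ η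

/-- The shadow `S(g) ⊆ ∂F` of a nontrivial group element `g`: the boundary points
having the reduced word of `g` as an initial segment. -/
def shadow (g : FreeGroup B) : Set (Boundary B) :=
  {ξ | prefixOf B ξ g.toWord.length = g}

end DecompPaper

open DecompPaper

namespace DecompPaper

/-- If each point has at most one partner under a symmetric relation, then the relation
together with the diagonal is the kernel of the quotient map. -/
theorem quot_mk_eq_iff_of_unique {Y : Type*} {R : Y → Y → Prop} (hsymm : ∀ a b, R a b → R b a)
    (huniq : ∀ a b c, R a b → R a c → b = c) (a b : Y) :
    Quot.mk R a = Quot.mk R b ↔ R a b ∨ a = b := by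
  constructor
  · intro h
    replace h := Quot.eqvGen_exact h
    induction h with
    | rel x y h => exact Or.inl h
    | refl x => exact Or.inr rfl
    | symm x y _ ih => exact ih.imp (hsymm _ _) Eq.symm
    | trans x y z _ _ ih₁ ih₂ =>
      rcases ih₁ with h₁ | rfl
      · rcases ih₂ with h₂ | rfl
        · exact Or.inr (huniq _ _ _ (hsymm _ _ h₁) h₂)
        · exact Or.inl h₁
      · exact ih₂
  · rintro (h | rfl)
    · exact Quot.sound h
    · rfl

/-- A finite clopen partition of a compact Hausdorff space `Y` induces an open cover without
triple intersections on the quotient of `Y` by a closed relation with classes of at most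
two points. -/
theorem exists_open_cover_quot {Y ι : Type*} [TopologicalSpace Y] [CompactSpace Y] [T2Space Y]
    [Finite ι] {R : Y → Y → Prop} (hsymm : ∀ a b, R a b → R b a)
    (huniq : ∀ a b c, R a b → R a c → b = c)
    (hclosed : IsClosed {p : Y × Y | R p.1 p.2 ∨ p.1 = p.2})
    {P : Y → ι} (hP : IsLocallyConstant P) :
    ∃ U : ι → Set (Quot R), (∀ c, IsOpen (U c)) ∧ (∀ y, Quot.mk R y ∈ U (P y)) ∧
      (∀ c c', c ≠ c' → (U c ∩ U c').Nonempty → ∃ a b, R a b ∧ P a = c ∧ P b = c') ∧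
      (∀ c c' c'', c ≠ c' → c' ≠ c'' → c ≠ c'' → U c ∩ U c' ∩ U c'' = ∅) := by
  have hsat : ∀ S : Set Y, IsClosed S →
      IsClosed {y | ∃ s ∈ S, R y s ∨ y = s} := by
    intro S hS
    have h : {y | ∃ s ∈ S, R y s ∨ y = s} =
        Prod.fst '' ({p : Y × Y | R p.1 p.2 ∨ p.1 = p.2} ∩ Prod.snd ⁻¹' S) := by
      ext y
      simp [and_comm]
    rw [h]
    exact isClosedMap_fst_of_compactSpace _ (hclosed.inter (hS.preimage continuous_snd))
  let A : ι → Set Y := fun c => {y | ∃ s ∈ P ⁻¹' {c}, R y s ∨ y = s} ∩ P ⁻¹' {c}ᶜ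
  have hAR : ∀ c y, y ∈ A c → P y ≠ c ∧ ∃ s, P s = c ∧ R y s := by
    rintro c y ⟨⟨s, hs, h | rfl⟩, hy⟩
    · exact ⟨hy, s, hs, h⟩
    · exact absurd hs hy
  have hRA : ∀ a b, R a b → P a ≠ P b → a ∈ A (P b) := fun a b h hne =>
    ⟨⟨b, rfl, Or.inl h⟩, hne⟩
  have hAclosed : ∀ c, IsClosed (A c) := fun c =>
    (hsat _ (hP.isClosed_fiber c)).inter ⟨by rw [← Set.preimage_compl, compl_compl]; exact hP _⟩
  obtain ⟨N, hN, hNdisj⟩ : ∃ N : ι → Set Y, (∀ c, N c ∈ nhdsSet (A c)) ∧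
      Pairwise (Function.onFun Disjoint N) := by
    refine Pairwise.exists_mem_filter_of_disjoint fun c c' hne => ?_
    rw [Function.onFun, separatedNhds_iff_disjoint.symm]
    refine normal_separation (hAclosed c) (hAclosed c') ?_
    refine Set.disjoint_left.2 fun y hy hy' => ?_
    obtain ⟨-, s, rfl, hs⟩ := hAR _ _ hy
    obtain ⟨-, s', rfl, hs'⟩ := hAR _ _ hy'
    exact hne (congrArg P (huniq _ _ _ hs hs'))
  let V : ι → Set Y := fun c =>
    P ⁻¹' {c} ∪ (interior (N c) ∩ P ⁻¹' {c' | c' ≠ c ∧ ∃ a ∈ A c, P a = c'})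
  have hVopen : ∀ c, IsOpen (V c) := fun c =>
    (hP.isOpen_fiber c).union (isOpen_interior.inter (hP _))
  have hmk := quot_mk_eq_iff_of_unique hsymm huniq
  have hUV : ∀ c y, Quot.mk R y ∈ (Quot.mk R '' (V c)ᶜ)ᶜ → y ∈ V c := fun c y h =>
    by_contra fun hy => h ⟨y, hy, rfl⟩
  have hV : ∀ c c' y, c ≠ c' → y ∈ V c → y ∈ V c' → P y = c ∨ P y = c' := by
    rintro c c' y hne (h | ⟨h, -⟩) (h' | ⟨h', -⟩)
    · exact Or.inl h
    · exact Or.inl h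
    · exact Or.inr h'
    · exact absurd (interior_subset h')
        (Set.disjoint_left.1 (hNdisj hne) (interior_subset h))
  have hline : ∀ c c' y, c ≠ c' → y ∈ V c' → P y = c → ∃ a b, R a b ∧ P a = c ∧ P b = c' := by
    rintro _ c' y hne (h | ⟨-, -, a, ha, hay⟩) rfl
    · exact absurd h hne
    · obtain ⟨-, s, hs, h⟩ := hAR _ _ ha
      exact ⟨a, s, h, hay, hs⟩
  refine ⟨fun c => (Quot.mk R '' (V c)ᶜ)ᶜ, fun c => ?_, fun y => ?_, ?_, ?_⟩
  · rw [isOpen_compl_iff, ← isQuotientMap_quot_mk.isClosed_preimage]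
    convert hsat _ (hVopen c).isClosed_compl using 1
    ext y
    simp only [Set.mem_preimage, Set.mem_image, Set.mem_ofPred_eq]
    exact exists_congr fun s => and_congr_right fun _ => by rw [eq_comm, hmk]
  · rintro ⟨s, hs, h⟩
    rw [hmk] at h
    rcases h with h | rfl
    · refine hs ?_
      by_cases hne : P s = P y
      · exact Or.inl hne
      · have hA := hRA _ _ h hne
        exact Or.inr ⟨subset_interior_iff_mem_nhdsSet.2 (hN _) hA, hne, s, hA, rfl⟩
    · exact hs (Or.inl rfl)
  · rintro c c' hne ⟨x, hx, hx'⟩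
    induction x using Quot.ind with | _ y => ?_
    have hy := hUV _ _ hx
    have hy' := hUV _ _ hx'
    rcases hV _ _ _ hne hy hy' with h | h
    · exact hline _ _ _ hne hy' h
    · obtain ⟨a, b, hab, ha, hb⟩ := hline _ _ _ hne.symm hy h
      exact ⟨b, a, hsymm _ _ hab, hb, ha⟩
  · intro c c' c'' h₁ h₂ h₃
    refine Set.eq_empty_of_forall_notMem ?_
    rintro x ⟨⟨hx, hx'⟩, hx''⟩
    induction x using Quot.ind with | _ y => ?_
    have e₁ := hV _ _ _ h₁ (hUV _ _ hx) (hUV _ _ hx')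
    have e₂ := hV _ _ _ h₂ (hUV _ _ hx') (hUV _ _ hx'')
    have e₃ := hV _ _ _ h₃ (hUV _ _ hx) (hUV _ _ hx'')
    grind

section Words

variable {B : Type} [DecidableEq B]

theorem toWord_mul_letter (u : FreeGroup B) (x : B × Bool) (P S : List (B × Bool))
    (hS : S ≠ []) (h : u.toWord = P ++ S) :
    ∃ S', (u * FreeGroup.mk [x]).toWord = P ++ S' ∧ S.length ≤ S'.length + 1 := by
  obtain ⟨S, y, rfl⟩ := List.eq_nil_or_concat' S |>.resolve_left hS
  have hred : FreeGroup.IsReduced (P ++ (S ++ [y])) := h ▸ FreeGroup.isReduced_toWord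
  have hu : u = FreeGroup.mk (P ++ (S ++ [y])) := by rw [← h, FreeGroup.mk_toWord]
  by_cases hxy : y.1 = x.1 ∧ y.2 = !x.2
  · refine ⟨S, ?_, by simp⟩
    have hstep : FreeGroup.mk (P ++ (S ++ [y]) ++ [x]) = FreeGroup.mk (P ++ S) := by
      obtain ⟨b, t⟩ := x
      obtain ⟨b', t'⟩ := y
      obtain ⟨rfl, rfl⟩ : b' = b ∧ t' = !t := hxy
      have := FreeGroup.Red.Step.not_rev (L₁ := P ++ S) (L₂ := []) (x := b') (b := t)
      simpa using (FreeGroup.reduce.exact (FreeGroup.reduce.Step.eq this))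
    rw [hu, FreeGroup.mul_mk, hstep, FreeGroup.toWord_mk]
    exact (hred.infix ⟨[], [y], by simp⟩).reduce_eq
  · refine ⟨S ++ [y] ++ [x], ?_, by simp⟩
    have hxred : FreeGroup.IsReduced ([y] ++ [x]) := by
      simp only [List.cons_append, List.nil_append, FreeGroup.isReduced_cons_cons,
        FreeGroup.IsReduced.singleton, and_true]
      intro h₁
      by_contra h₂
      exact hxy ⟨h₁, by cases hy : y.2 <;> cases hx : x.2 <;> simp_all⟩
    have := FreeGroup.IsReduced.append_overlap (L₁ := P ++ S) (by simpa using hred) hxred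
      (by simp)
    rw [hu, FreeGroup.mul_mk, FreeGroup.toWord_mk]
    simpa using this.reduce_eq

/-- Right multiplication by a word of length at most `S.length` does not affect the part of
a reduced word preceding `S`. -/
theorem prefix_toWord_mul (P : List (B × Bool)) (L : List (B × Bool)) :
    ∀ (u : FreeGroup B) (S : List (B × Bool)), u.toWord = P ++ S → L.length ≤ S.length →
      P <+: (u * FreeGroup.mk L).toWord := by
  induction L with
  | nil =>
    intro u S h _
    rw [← FreeGroup.one_eq_mk, mul_one, h]
    exact List.prefix_append _ _
  | cons x L ih =>
    intro u S h hL
    obtain ⟨S', hS', hlen⟩ := toWord_mul_letter u x P S (by rintro rfl; simp at hL) h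
    have := ih _ S' hS' (by simp at hL; omega)
    rwa [mul_assoc, FreeGroup.mul_mk] at this

/-- If a path `a, a * v, …, a * v ^ n` enters the set of words beginning with `P`, then it
passes close to the vertex `P`. -/
theorem exists_pow_eq_mk_mul {P : List (B × Bool)} {a v : FreeGroup B} {n : ℕ}
    (h₀ : ¬ P <+: a.toWord) (hn : P <+: (a * v ^ n).toWord) :
    ∃ k : ℕ, ∃ x : FreeGroup B, x.toWord.length ≤ v.toWord.length ∧
      a * v ^ k = FreeGroup.mk P * x := by
  induction n with
  | zero => simp at hn; exact absurd hn h₀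
  | succ n ih =>
    by_cases h : P <+: (a * v ^ n).toWord
    · exact ih h
    obtain ⟨S, hS⟩ := hn
    refine ⟨n + 1, FreeGroup.mk S, ?_, ?_⟩
    · have hSw : S.length < v.toWord.length := by
        by_contra! hlt
        apply h
        have := prefix_toWord_mul P (v⁻¹).toWord _ S hS.symm
          (by simpa [FreeGroup.toWord_inv] using hlt)
        rwa [FreeGroup.mk_toWord, pow_succ, ← mul_assoc, mul_inv_cancel_right] at this
      have : (FreeGroup.mk S).toWord.length ≤ S.length := FreeGroup.norm_mk_le
      omega
    · rw [FreeGroup.mul_mk, hS, FreeGroup.mk_toWord]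

theorem finite_toWord_length_le [Finite B] (n : ℕ) :
    {x : FreeGroup B | x.toWord.length ≤ n}.Finite :=
  Set.Finite.preimage FreeGroup.toWord_injective.injOn (List.finite_length_le (B × Bool) n)

end Words

section Boundary

variable {B : Type}

theorem isReduced_ofFn (ξ : Boundary B) (m : ℕ) :
    FreeGroup.IsReduced (List.ofFn fun i : Fin m => ξ.1 i) := by
  rw [FreeGroup.IsReduced, List.isChain_iff_getElem]
  intro i hi h₁
  have h := ξ.2 i
  simp only [List.getElem_ofFn] at h₁ ⊢
  by_contra h₂
  exact h (Prod.ext h₁.symm (by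
    cases h₃ : (ξ.1 i).2 <;> cases h₄ : (ξ.1 (i + 1)).2 <;> simp_all))

theorem adj_prefixOf_succ (ξ : Boundary B) (m : ℕ) :
    Adj B (prefixOf B ξ m) (prefixOf B ξ (m + 1)) :=
  ⟨ξ.1 m, by rw [prefixOf, prefixOf, FreeGroup.mul_mk, List.ofFn_succ']; simp⟩

theorem Adj.symm {g h : FreeGroup B} (H : Adj B g h) : Adj B h g := by
  obtain ⟨x, rfl⟩ := H
  refine ⟨(x.1, !x.2), ?_⟩
  have : FreeGroup.mk [(x.1, !x.2)] = (FreeGroup.mk [x])⁻¹ := by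
    simp [FreeGroup.inv_mk, FreeGroup.invRev]
  rw [this, mul_inv_cancel_right]

theorem boundary_ext {ξ η : Boundary B}
    (h : ∀ m, (List.ofFn fun i : Fin m => ξ.1 i) = List.ofFn fun i : Fin m => η.1 i) : ξ = η := by
  refine Subtype.ext (funext fun k => ?_)
  exact congrFun (List.ofFn_injective (h (k + 1))) (Fin.last k)

theorem ofFn_eq_of_prefix {ξ η : Boundary B} {m : ℕ} {L : List (B × Bool)}
    (h₁ : (List.ofFn fun i : Fin m => ξ.1 i) <+: L)
    (h₂ : (List.ofFn fun i : Fin m => η.1 i) <+: L) :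
    (List.ofFn fun i : Fin m => ξ.1 i) = List.ofFn fun i : Fin m => η.1 i :=
  (List.prefix_of_prefix_length_le h₁ h₂ (by simp)).eq_of_length (by simp)

theorem exists_ofFn_ne {ξ η : Boundary B} (h : ξ ≠ η) :
    ∃ m, (List.ofFn fun i : Fin m => ξ.1 i) ≠ List.ofFn fun i : Fin m => η.1 i := by
  by_contra! h'
  exact h (boundary_ext h')

instance : DiscreteTopology (B × Bool) := ⟨rfl⟩

instance [Finite B] : CompactSpace (Boundary B) := by
  have hclosed : IsClosed {s : ℕ → B × Bool | ∀ k, s (k + 1) ≠ ((s k).1, !(s k).2)} := by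
    rw [Set.ofPred_forall]
    refine isClosed_iInter fun k => ?_
    have hc : Continuous fun s : ℕ → B × Bool => (s k, s (k + 1)) := by fun_prop
    exact (isClosed_discrete {p : (B × Bool) × (B × Bool) | p.2 ≠ (p.1.1, !p.1.2)}).preimage hc
  exact isCompact_iff_compactSpace.1 hclosed.isCompact

theorem isLocallyConstant_ofFn (m : ℕ) :
    IsLocallyConstant fun ξ : Boundary B => List.ofFn fun i : Fin m => ξ.1 i := by
  have h : IsLocallyConstant fun ξ : Boundary B => fun i : Fin m => ξ.1 i :=
    (IsLocallyConstant.iff_continuous _).2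
      (continuous_pi fun i => (continuous_apply _).comp continuous_subtype_val)
  exact h.comp List.ofFn

variable [DecidableEq B]

theorem toWord_prefixOf (ξ : Boundary B) (m : ℕ) :
    (prefixOf B ξ m).toWord = List.ofFn fun i : Fin m => ξ.1 i :=
  (FreeGroup.toWord_mk).trans (isReduced_ofFn ξ m).reduce_eq

theorem length_toWord_prefixOf (ξ : Boundary B) (m : ℕ) :
    (prefixOf B ξ m).toWord.length = m := by
  rw [toWord_prefixOf, List.length_ofFn]

theorem TendstoBoundary.unique {a : ℕ → FreeGroup B} {ξ η : Boundary B}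
    (h₁ : TendstoBoundary B a ξ) (h₂ : TendstoBoundary B a η) : ξ = η := by
  refine boundary_ext fun m => ?_
  obtain ⟨K₁, hK₁⟩ := h₁ m
  obtain ⟨K₂, hK₂⟩ := h₂ m
  exact ofFn_eq_of_prefix (hK₁ (K₁ + K₂) (by omega)) (hK₂ (K₁ + K₂) (by omega))

/-- Limits along powers of `v` do not depend on the base point in the coset `h⟨v⟩`. -/
theorem TendstoBoundary.mul_zpow {h v : FreeGroup B} {ξ : Boundary B}
    (hξ : TendstoBoundary B (fun k => h * v ^ k) ξ) (c : ℤ) :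
    TendstoBoundary B (fun k => h * v ^ c * v ^ k) ξ := by
  intro m
  obtain ⟨K, hK⟩ := hξ m
  refine ⟨K + c.natAbs, fun k hk => ?_⟩
  have e : h * v ^ c * v ^ k = h * v ^ (c + k).toNat := by
    rw [mul_assoc, ← zpow_natCast, ← zpow_natCast, ← zpow_add, Int.toNat_of_nonneg (by omega)]
  simp only [e]
  exact hK _ (by omega)

/-- Long prefixes of the limit of `g * v ^ k` stay close to the coset `g⟨v⟩`. -/
theorem TendstoBoundary.exists_prefixOf_eq {g v : FreeGroup B} {ξ : Boundary B}
    (h : TendstoBoundary B (fun k => g * v ^ k) ξ) {n : ℕ} (hn : g.toWord.length < n) :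
    ∃ k : ℕ, ∃ x : FreeGroup B, x.toWord.length ≤ v.toWord.length ∧
      g * v ^ k = prefixOf B ξ n * x := by
  obtain ⟨K, hK⟩ := h n
  refine exists_pow_eq_mk_mul (fun hp => ?_) (hK K le_rfl)
  have := hp.length_le
  rw [List.length_ofFn] at this
  omega

/-- If powers of `v` based at `g` and powers of `u` based at `h` have the same limit, then the
corresponding cyclic subgroups are commensurable. -/
theorem exists_conj_zpow_of_tendsto [Finite B] {g h u v : FreeGroup B} {ξ : Boundary B}
    (h₁ : TendstoBoundary B (fun k => g * v ^ k) ξ)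
    (h₂ : TendstoBoundary B (fun k => h * u ^ k) ξ) :
    ∃ a b : ℤ, v ^ a ≠ 1 ∧ g * v ^ a * g⁻¹ = h * u ^ b * h⁻¹ := by
  let N := g.toWord.length + h.toWord.length + 1
  choose k x hx hk using fun n : ℕ =>
    h₁.exists_prefixOf_eq (n := N + n) (by omega)
  choose l y hy hl using fun n : ℕ =>
    h₂.exists_prefixOf_eq (n := N + n) (by omega)
  have hfin := (finite_toWord_length_le (B := B) v.toWord.length).prod
    (finite_toWord_length_le (B := B) u.toWord.length)
  obtain ⟨n, -, n', -, hne, heq⟩ := Set.infinite_univ.exists_ne_map_eq_of_mapsTo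
    (f := fun n : ℕ => (x n, y n)) (fun n _ => Set.mk_mem_prod (hx n) (hy n)) hfin
  obtain ⟨hxx, hyy⟩ := Prod.mk.inj heq
  have hp : prefixOf B ξ (N + n) ≠ prefixOf B ξ (N + n') := fun e => by
    have := congrArg (fun z => z.toWord.length) e
    simp only [length_toWord_prefixOf] at this
    omega
  have aux : ∀ (c z : FreeGroup B) (s t : ℕ) (p p' q : FreeGroup B), c * z ^ s = p * q →
      c * z ^ t = p' * q → c * z ^ ((s : ℤ) - t) * c⁻¹ = p * p'⁻¹ := by
    intro c z s t p p' q e e'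
    have e₁ : p = c * z ^ s * q⁻¹ := by rw [e]; group
    have e₂ : p' = c * z ^ t * q⁻¹ := by rw [e']; group
    rw [e₁, e₂]; group
  have ha := aux g v (k n) (k n') _ _ _ (hk n) (hxx ▸ hk n')
  have hb := aux h u (l n) (l n') _ _ _ (hl n) (hyy ▸ hl n')
  refine ⟨_, _, fun h1 => hp ?_, ha.trans hb.symm⟩
  rw [h1, mul_one, mul_inv_cancel] at ha
  exact (mul_inv_eq_one.1 ha.symm)

end Boundary

section Lines

variable {B : Type} [DecidableEq B] {r : ℕ} {w : Fin r → FreeGroup B}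

theorem isLine_iff {ξ η : Boundary B} : IsLine B w ξ η ↔
    ∃ (g : FreeGroup B) (i : Fin r) (v : FreeGroup B), (v = w i ∨ v = (w i)⁻¹) ∧
      TendstoBoundary B (fun k => g * v ^ k) ξ ∧ TendstoBoundary B (fun k => g * v⁻¹ ^ k) η := by
  constructor
  · rintro ⟨g, i, ⟨h₁, h₂⟩ | ⟨h₁, h₂⟩⟩
    · exact ⟨g, i, w i, Or.inl rfl, h₁, h₂⟩
    · exact ⟨g, i, (w i)⁻¹, Or.inr rfl, h₂, by simpa using h₁⟩
  · rintro ⟨g, i, v, rfl | rfl, h₁, h₂⟩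
    · exact ⟨g, i, Or.inl ⟨h₁, h₂⟩⟩
    · exact ⟨g, i, Or.inr ⟨by simpa using h₂, h₁⟩⟩

theorem IsLine.symm {ξ η : Boundary B} (h : IsLine B w ξ η) : IsLine B w η ξ := by
  obtain ⟨g, i, h⟩ := h
  exact ⟨g, i, h.symm⟩

/-- By malnormality, distinct lines have disjoint sets of endpoints. -/
theorem IsLine.unique [Finite B] (hmal : Malnormal B w) {ξ η η' : Boundary B}
    (h : IsLine B w ξ η) (h' : IsLine B w ξ η') : η = η' := by
  obtain ⟨g, i, v, hv, h₁, h₂⟩ := isLine_iff.1 h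
  obtain ⟨g', j, v', hv', h₁', h₂'⟩ := isLine_iff.1 h'
  obtain ⟨a, b, hne, hab⟩ := exists_conj_zpow_of_tendsto h₁ h₁'
  have hvz : ∀ (i : Fin r) (v : FreeGroup B), (v = w i ∨ v = (w i)⁻¹) →
      Subgroup.zpowers v = Subgroup.zpowers (w i) := by
    rintro i v (rfl | rfl)
    · rfl
    · exact Subgroup.zpowers_inv
  obtain ⟨rfl, hz⟩ := hmal (g'⁻¹ * g) i j ⟨v ^ a, hvz i v hv ▸ ⟨a, rfl⟩, hne, by
    have : g'⁻¹ * g * v ^ a * (g'⁻¹ * g)⁻¹ = v' ^ b := by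
      calc _ = g'⁻¹ * (g * v ^ a * g⁻¹) * g' := by group
        _ = v' ^ b := by rw [hab]; group
    rw [this, ← hvz j v' hv']
    exact ⟨b, rfl⟩⟩
  rw [← hvz i v' hv'] at hz
  obtain ⟨c, hc⟩ := hz
  obtain rfl : g = g' * v' ^ c := by
    rw [show v' ^ c = g'⁻¹ * g from hc]; group
  have hvv : v = v' ∨ v = v'⁻¹ := by
    rcases hv with rfl | rfl <;> rcases hv' with rfl | rfl <;> simp
  have hinv : v' ^ c = v'⁻¹ ^ (-c) := by simp
  rcases hvv with rfl | rfl
  · rw [hinv] at h₂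
    exact h₂.unique (h₂'.mul_zpow _)
  · rw [inv_inv] at h₂
    rw [hinv] at h₁
    exact (h₂.unique (h₁'.mul_zpow _)).trans (h₁.unique (h₂'.mul_zpow _))

/-- Only finitely many lines join two disjoint cylinders of the boundary. -/
theorem finite_lines_between [Finite B] {P Q : List (B × Bool)} (hlen : P.length = Q.length)
    (hPQ : P ≠ Q) :
    {p : Boundary B × Boundary B | IsLine B w p.1 p.2 ∧
      (List.ofFn fun i : Fin P.length => p.1.1 i) = P ∧
      (List.ofFn fun i : Fin P.length => p.2.1 i) = Q}.Finite := by
  let S (v x : FreeGroup B) : Set (Boundary B × Boundary B) :=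
    {p | TendstoBoundary B (fun k => FreeGroup.mk P * x * v ^ k) p.1 ∧
      TendstoBoundary B (fun k => FreeGroup.mk P * x * v⁻¹ ^ k) p.2}
  have hS : ∀ v x, (S v x).Finite := fun v x =>
    Set.Subsingleton.finite fun p hp p' hp' =>
      Prod.ext (hp.1.unique hp'.1) (hp.2.unique hp'.2)
  refine Set.Finite.subset (Set.finite_iUnion fun i : Fin r =>
    (Set.toFinite {w i, (w i)⁻¹}).biUnion fun v _ =>
      (finite_toWord_length_le v.toWord.length).biUnion fun x _ => hS v x) ?_
  rintro ⟨ξ, η⟩ ⟨hline, hP, hQ⟩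
  obtain ⟨g, i, v, hv, h₁, h₂⟩ := isLine_iff.1 hline
  obtain ⟨K₁, hK₁⟩ := h₁ P.length
  obtain ⟨K₂, hK₂⟩ := h₂ P.length
  dsimp only at hP hQ
  have hP' : P <+: (g * v ^ K₁).toWord := by simpa only [hP] using hK₁ K₁ le_rfl
  have hQ' : Q <+: (g * v⁻¹ ^ K₂).toWord := by simpa only [hQ] using hK₂ K₂ le_rfl
  have hnP : ¬ P <+: (g * v⁻¹ ^ K₂).toWord := fun h =>
    hPQ ((List.prefix_of_prefix_length_le h hQ' hlen.le).eq_of_length hlen)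
  obtain ⟨k, x, hx, hk⟩ := exists_pow_eq_mk_mul (v := v) (n := K₂ + K₁) hnP (by
    rwa [pow_add, inv_pow, mul_assoc, inv_mul_cancel_left])
  simp only [Set.mem_iUnion]
  have hbase : FreeGroup.mk P * x = g * v ^ ((k : ℤ) - K₂) := by rw [← hk]; group
  have hbase' : FreeGroup.mk P * x = g * v⁻¹ ^ ((K₂ : ℤ) - k) := by rw [← hk]; group
  refine ⟨i, v, by simpa using hv, x, hx, ?_, ?_⟩
  · simpa only [hbase] using h₁.mul_zpow _
  · simpa only [hbase'] using h₂.mul_zpow _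

/-- The equivalence relation defining the decomposition space is closed. -/
theorem isClosed_isLine_or_eq [Finite B] :
    IsClosed {p : Boundary B × Boundary B | IsLine B w p.1 p.2 ∨ p.1 = p.2} := by
  rw [← isOpen_compl_iff, isOpen_iff_mem_nhds]
  rintro ⟨ξ, η⟩ hp
  have hne : ξ ≠ η := fun h => hp (Or.inr h)
  obtain ⟨m, hm⟩ := exists_ofFn_ne hne
  have hO₁ := ((isLocallyConstant_ofFn m).isOpen_fiber (List.ofFn fun i : Fin m => ξ.1 i)).preimage
    (continuous_fst : Continuous (Prod.fst : Boundary B × Boundary B → _))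
  have hO₂ := ((isLocallyConstant_ofFn m).isOpen_fiber (List.ofFn fun i : Fin m => η.1 i)).preimage
    (continuous_snd : Continuous (Prod.snd : Boundary B × Boundary B → _))
  have hfin := finite_lines_between (w := w) (by simp) hm
  simp only [List.length_ofFn] at hfin
  filter_upwards [hO₁.mem_nhds rfl, hO₂.mem_nhds rfl,
    hfin.isClosed.isOpen_compl.mem_nhds fun h => hp (Or.inl h.1)] with p h₁ h₂ h₃
  rintro (h | h)
  · exact h₃ ⟨h, h₁, h₂⟩
  · exact hm (h₁.symm.trans ((congrArg (fun ζ : Boundary B =>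
      List.ofFn fun i : Fin m => ζ.1 i) h).trans h₂))

end Lines

section Components

variable {B : Type} {X : Set (FreeGroup B)}

/-- The connected component of a vertex in `T ∖ X`. -/
def componentAt (X : Set (FreeGroup B)) (v : FreeGroup B) : Set (FreeGroup B) :=
  {u | Relation.ReflTransGen (fun a b => Adj B a b ∧ a ∉ X ∧ b ∉ X) v u}

theorem componentAt_eq_of_mem {u v : FreeGroup B} (h : u ∈ componentAt X v) :
    componentAt X u = componentAt X v := by
  have : Std.Symm fun a b : FreeGroup B => Adj B a b ∧ a ∉ X ∧ b ∉ X :=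
    ⟨fun _ _ h => ⟨h.1.symm, h.2.2, h.2.1⟩⟩
  have hsymm : Relation.ReflTransGen (fun a b => Adj B a b ∧ a ∉ X ∧ b ∉ X) u v :=
    Relation.ReflTransGen.stdSymm.symm _ _ h
  ext z
  exact ⟨fun hz => h.trans hz, fun hz => hsymm.trans hz⟩

theorem mem_componentAt_self (v : FreeGroup B) : v ∈ componentAt X v :=
  Relation.ReflTransGen.refl

theorem reflTransGen_adj_one (v : FreeGroup B) : Relation.ReflTransGen (Adj B) v 1 := by
  have : Std.Symm (Adj B) := ⟨fun _ _ h => h.symm⟩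
  refine Relation.ReflTransGen.stdSymm.symm _ _ ?_
  induction v using Quot.ind with | _ L => ?_
  induction L using List.reverseRecOn with
  | nil => exact Relation.ReflTransGen.refl
  | append_singleton L x ih => exact ih.tail ⟨x, FreeGroup.mul_mk.symm⟩

/-- Each component of the complement of `X` contains a vertex adjacent to `X`. -/
theorem exists_adj_mem_componentAt (hXe : (1 : FreeGroup B) ∈ X) {v : FreeGroup B} (hv : v ∉ X) :
    ∃ u ∈ componentAt X v, u ∉ X ∧ ∃ x ∈ X, Adj B x u := by
  revert hv
  induction reflTransGen_adj_one v using Relation.ReflTransGen.head_induction_on with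
  | refl => exact fun h => absurd hXe h
  | @head a c h _ ih =>
    intro ha
    by_cases hc : c ∈ X
    · exact ⟨a, mem_componentAt_self a, ha, c, hc, h.symm⟩
    · obtain ⟨u, hu, hu'⟩ := ih hc
      exact ⟨u, Relation.ReflTransGen.head ⟨h, ha, hc⟩ hu, hu'⟩

theorem finite_components [Finite B] (hX : X.Finite) (hXe : (1 : FreeGroup B) ∈ X) :
    Finite {C : Set (FreeGroup B) // IsComponentOf B X C} := by
  have hN : (⋃ x ∈ X, Set.range fun l : B × Bool => x * FreeGroup.mk [l]).Finite :=
    hX.biUnion fun x _ => Set.finite_range _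
  refine Set.Finite.subset (hN.image (componentAt X)) ?_
  rintro C ⟨v, hv, rfl⟩
  obtain ⟨u, hu, -, x, hx, l, rfl⟩ := exists_adj_mem_componentAt hXe hv
  exact ⟨_, Set.mem_biUnion hx ⟨l, rfl⟩, componentAt_eq_of_mem hu⟩

variable [DecidableEq B]

theorem exists_length_toWord_lt (hX : X.Finite) : ∃ N, ∀ x ∈ X, x.toWord.length < N := by
  obtain ⟨N, hN⟩ := (hX.image fun x => x.toWord.length).bddAbove
  exact ⟨N + 1, fun x hx => Nat.lt_succ_of_le (hN ⟨x, hx, rfl⟩)⟩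

theorem prefixOf_notMem {N : ℕ} (hN : ∀ x ∈ X, x.toWord.length < N) (ξ : Boundary B) {k : ℕ}
    (hk : N ≤ k) : prefixOf B ξ k ∉ X := fun h => by
  have := hN _ h
  rw [length_toWord_prefixOf] at this
  omega

theorem prefixOf_mem_componentAt {N : ℕ} (hN : ∀ x ∈ X, x.toWord.length < N) (ξ : Boundary B)
    {k : ℕ} (hk : N ≤ k) : prefixOf B ξ k ∈ componentAt X (prefixOf B ξ N) := by
  induction k, hk using Nat.le_induction with
  | base => exact mem_componentAt_self _
  | succ k hk ih =>
    exact Relation.ReflTransGen.tail ih ⟨adj_prefixOf_succ ξ k, prefixOf_notMem hN ξ hk,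
      prefixOf_notMem hN ξ (hk.trans k.le_succ)⟩

theorem mem_boundaryOf_iff {N : ℕ} (hN : ∀ x ∈ X, x.toWord.length < N) {C : Set (FreeGroup B)}
    (hC : IsComponentOf B X C) (ξ : Boundary B) :
    ξ ∈ boundaryOf B C ↔ componentAt X (prefixOf B ξ N) = C := by
  constructor
  · rintro ⟨m, hm⟩
    obtain ⟨v, -, rfl⟩ := hC
    exact (componentAt_eq_of_mem (prefixOf_mem_componentAt hN ξ (le_max_right m N))).symm.trans
      (componentAt_eq_of_mem (hm _ (le_max_left m N)))
  · rintro rfl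
    exact ⟨N, fun k hk => prefixOf_mem_componentAt hN ξ hk⟩

end Components

end DecompPaper

/-- Lemma `construction`: for every finite nonempty subtree `X` of
`T` containing `e`, there is a finite open cover of `D` indexed by the connected
components of `T ∖ X`, with `q(∂C) ⊆ U C`, nonempty pairwise intersections exactly
along lines joining the corresponding boundary pieces, and no triple intersections. -/
theorem decomposition_space_cover_of_subtree
    (B : Type) [Fintype B] [DecidableEq B] (hB : 2 ≤ Fintype.card B)
    (r : ℕ) (w : Fin r → FreeGroup B) (hw : ∀ i, w i ≠ 1) (hmal : Malnormal B w)
    (X : Set (FreeGroup B)) (hXfin : X.Finite) (hXne : X.Nonempty)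
    (hXtree : IsSubtree B X) (hXe : (1 : FreeGroup B) ∈ X) :
    Finite {C : Set (FreeGroup B) // IsComponentOf B X C} ∧
    ∃ U : {C : Set (FreeGroup B) // IsComponentOf B X C} → Set (DSpace B w),
      (∀ C, IsOpen (U C)) ∧
      (⋃ C, U C) = Set.univ ∧
      (∀ C, qmap B w '' boundaryOf B C.1 ⊆ U C) ∧
      (∀ C C', C ≠ C' →
        ((U C ∩ U C').Nonempty ↔
          ∃ ξ η, IsLine B w ξ η ∧ ξ ∈ boundaryOf B C.1 ∧ η ∈ boundaryOf B C'.1)) ∧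
      (∀ C C' C'', C ≠ C' → C' ≠ C'' → C ≠ C'' → U C ∩ U C' ∩ U C'' = ∅) := by
  obtain ⟨N, hN⟩ := exists_length_toWord_lt hXfin
  have hfin := finite_components hXfin hXe
  let P : Boundary B → {C : Set (FreeGroup B) // IsComponentOf B X C} := fun ξ =>
    ⟨componentAt X (prefixOf B ξ N), prefixOf B ξ N, prefixOf_notMem hN ξ le_rfl, rfl⟩
  have hmem : ∀ C ξ, ξ ∈ boundaryOf B C.1 ↔ P ξ = C := fun C ξ =>
    (mem_boundaryOf_iff hN C.2 ξ).trans (Subtype.ext_iff (a1 := P ξ) (a2 := C)).symm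
  have hP : IsLocallyConstant P := by
    refine (IsLocallyConstant.iff_exists_open P).2 fun ξ =>
      ⟨_, (isLocallyConstant_ofFn N).isOpen_fiber _, rfl, fun η hη => Subtype.ext ?_⟩
    exact congrArg (fun L => componentAt X (FreeGroup.mk L)) hη
  obtain ⟨U, hopen, hcover, hpair, htriple⟩ := exists_open_cover_quot
    (fun _ _ h => IsLine.symm h) (fun _ _ _ h h' => IsLine.unique hmal h h')
    (isClosed_isLine_or_eq (w := w)) hP
  refine ⟨hfin, U, hopen, ?_, ?_, fun C C' hne => ⟨fun h => ?_, ?_⟩, htriple⟩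
  · refine Set.eq_univ_of_forall fun x => ?_
    induction x using Quot.ind with | _ ξ => ?_
    exact Set.mem_iUnion.2 ⟨P ξ, hcover ξ⟩
  · rintro C _ ⟨ξ, hξ, rfl⟩
    exact (hmem C ξ).1 hξ ▸ hcover ξ
  · obtain ⟨ξ, η, hline, hξ, hη⟩ := hpair C C' hne h
    exact ⟨ξ, η, hline, (hmem C ξ).2 hξ, (hmem C' η).2 hη⟩
  · rintro ⟨ξ, η, hline, hξ, hη⟩
    refine ⟨qmap B w ξ, (hmem C ξ).1 hξ ▸ hcover ξ, ?_⟩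
    rw [show qmap B w ξ = qmap B w η from Quot.sound hline]
    exact (hmem C' η).1 hη ▸ hcover η
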